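/- For every m ≥ 1, every simple perfect matching of CGG(2m) is a co-blocker; in particular, every co-blocker of CGG(2m) has exactly m edges. -/

import Mathlib

/-- The vertex set of the complete convex geometric graph `CGG(2m)`:
the vertices are labelled cyclically by `0, 1, …, 2m-1`. -/
abbrev Vtx (m : ℕ) := ZMod (2 * m)

/-- The order of an edge `{i,j}` of `CGG(2m)`: `min (|i-j|, 2m - |i-j|)`. -/
def edgeOrder (m : ℕ) : Sym2 (Vtx m) → ℕ :=
  Sym2.lift ⟨fun i j => min (i - j).val (j - i).val, fun i j => min_comm _ _⟩

/-- The direction of an edge `{i,j}` of `CGG(2m)`: `i + j (mod 2m)`. -/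
def edgeDir (m : ℕ) : Sym2 (Vtx m) → Vtx m :=
  Sym2.lift ⟨fun i j => i + j, fun i j => add_comm i j⟩

/-- `x` lies on the open cyclic arc from `a` to `b`, taken counterclockwise. -/
def InArc (m : ℕ) (a b x : Vtx m) : Prop :=
  0 < (x - a).val ∧ (x - a).val < (b - a).val

/-- Two edges of `CGG(2m)` cross: their endpoints interleave in the cyclic order,
i.e. writing them as `{a,b}` and `{c,d}`, exactly one of `c, d` lies on the open
cyclic arc from `a` to `b` taken counterclockwise. -/
def Crosses (m : ℕ) (e f : Sym2 (Vtx m)) : Prop :=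
  ∃ a b c d : Vtx m, e = s(a, b) ∧ f = s(c, d) ∧
    Xor' (InArc m a b c) (InArc m a b d)

/-- Two edges of `CGG(2m)` are neighbors: some endpoint of one differs by `±1`
(mod `2m`) from some endpoint of the other. -/
def Neighbors (m : ℕ) (e f : Sym2 (Vtx m)) : Prop :=
  ∃ x ∈ e, ∃ y ∈ f, x = y + 1 ∨ y = x + 1

/-- `M` is a perfect matching of `CGG(2m)`: a set of pairwise vertex-disjoint
edges covering all `2m` vertices. -/
def IsPM (m : ℕ) (M : Finset (Sym2 (Vtx m))) : Prop :=
  (∀ e ∈ M, ¬ e.IsDiag) ∧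
  (∀ e ∈ M, ∀ f ∈ M, e ≠ f → ∀ x : Vtx m, x ∈ e → x ∉ f) ∧
  (∀ x : Vtx m, ∃ e ∈ M, x ∈ e)

/-- `M` is a simple perfect matching (SPM) of `CGG(2m)`: a perfect matching
no two of whose edges cross. -/
def IsSPM (m : ℕ) (M : Finset (Sym2 (Vtx m))) : Prop :=
  IsPM m M ∧ ∀ e ∈ M, ∀ f ∈ M, e ≠ f → ¬ Crosses m e f

/-- `M` is a semi-simple perfect matching of `CGG(2m)`: a perfect matching all of
whose edges have odd order, and no two neighboring edges of which cross. -/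
def IsSemiSimple (m : ℕ) (M : Finset (Sym2 (Vtx m))) : Prop :=
  IsPM m M ∧ (∀ e ∈ M, Odd (edgeOrder m e)) ∧
  ∀ e ∈ M, ∀ f ∈ M, e ≠ f → Neighbors m e f → ¬ Crosses m e f

/-- `B` is a set of edges of `CGG(2m)` that meets every member of the family `F`,
of minimum cardinality among all sets of edges meeting every member of `F`. -/
def MinTransversal (m : ℕ) (F : Set (Finset (Sym2 (Vtx m))))
    (B : Finset (Sym2 (Vtx m))) : Prop :=
  (∀ e ∈ B, ¬ e.IsDiag) ∧ (∀ M ∈ F, (B ∩ M).Nonempty) ∧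
  ∀ B' : Finset (Sym2 (Vtx m)), (∀ e ∈ B', ¬ e.IsDiag) →
    (∀ M ∈ F, (B' ∩ M).Nonempty) → B.card ≤ B'.card

/-- `B` is a blocker of `CGG(2m)`: a set of edges meeting every SPM, of minimum
cardinality among all sets of edges meeting every SPM. -/
def IsBlocker (m : ℕ) (B : Finset (Sym2 (Vtx m))) : Prop :=
  MinTransversal m {M | IsSPM m M} B

/-- `C` is a co-blocker of `CGG(2m)`: a set of edges meeting every blocker, of
minimum cardinality among all sets of edges meeting every blocker. -/
def IsCoBlocker (m : ℕ) (C : Finset (Sym2 (Vtx m))) : Prop :=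
  MinTransversal m {B | IsBlocker m B} C

/-- A finset meeting `m` pairwise disjoint finsets has at least `m` elements. -/
lemma le_card_of_forall_inter_nonempty {α : Type*} [DecidableEq α] {m : ℕ} {B : Finset α}
    (F : ℕ → Finset α) (hF : ∀ i < m, ∀ j < m, ∀ e ∈ F i, e ∈ F j → i = j)
    (hB : ∀ i < m, (B ∩ F i).Nonempty) : m ≤ B.card := by
  rcases isEmpty_or_nonempty α with hα | hα
  · rcases Nat.eq_zero_or_pos m with rfl | hm
    · exact Nat.zero_le _
    · exact isEmptyElim (hB 0 hm).choose
  choose! g hg using hB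
  have h := Finset.card_le_card_of_injOn (s := Finset.range m) (t := B) g
    (fun i hi => (Finset.mem_inter.1 (hg i (Finset.mem_range.1 hi))).1) (by
      intro i hi j hj hij
      have hi' := Finset.mem_range.1 (Finset.mem_coe.1 hi)
      have hj' := Finset.mem_range.1 (Finset.mem_coe.1 hj)
      exact hF i hi' j hj' (g i) (Finset.mem_inter.1 (hg i hi')).2
        (hij ▸ (Finset.mem_inter.1 (hg j hj')).2))
  simpa using h

/-- The parity of a vertex of `CGG(2m)`. -/
def vtxParity (m : ℕ) : Vtx m →+* ZMod 2 := ZMod.castHom (dvd_mul_right 2 m) (ZMod 2)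

lemma vtxParity_two_mul (m k : ℕ) : vtxParity m ((2 * k : ℕ) : Vtx m) = 0 := by
  rw [map_natCast, ZMod.natCast_eq_zero_iff]
  exact dvd_mul_right 2 k

lemma vtxParity_two_mul_add_one (m k : ℕ) : vtxParity m ((2 * k + 1 : ℕ) : Vtx m) = 1 := by
  rw [Nat.cast_add, map_add, vtxParity_two_mul, Nat.cast_one, map_one, zero_add]

lemma natCast_vtx_inj {m a b : ℕ} (ha : a < 2 * m) (hb : b < 2 * m)
    (h : (a : Vtx m) = (b : Vtx m)) : a = b := by
  rw [← ZMod.val_cast_of_lt ha, ← ZMod.val_cast_of_lt hb, h]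

/-- The star of edges of odd order at the vertex `v`. -/
def oddStar (m : ℕ) (v : Vtx m) : Finset (Sym2 (Vtx m)) :=
  (Finset.range m).image fun k => s(v, v + (2 * k + 1 : ℕ))

lemma card_oddStar_le (m : ℕ) (v : Vtx m) : (oddStar m v).card ≤ m :=
  Finset.card_image_le.trans_eq (Finset.card_range m)

lemma not_isDiag_of_mem_oddStar {m : ℕ} {v : Vtx m} {e : Sym2 (Vtx m)} (he : e ∈ oddStar m v) :
    ¬ e.IsDiag := by
  obtain ⟨k, -, rfl⟩ := Finset.mem_image.1 he
  rw [Sym2.mk_isDiag_iff]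
  intro h
  have h' := congrArg (vtxParity m) h
  rw [map_add, vtxParity_two_mul_add_one] at h'
  simp at h'

lemma oddStar_even_disjoint {m i j : ℕ} (hi : i < m) (hj : j < m) {e : Sym2 (Vtx m)}
    (hei : e ∈ oddStar m (2 * i : ℕ)) (hej : e ∈ oddStar m (2 * j : ℕ)) : i = j := by
  obtain ⟨k, -, rfl⟩ := Finset.mem_image.1 hei
  obtain ⟨l, -, h⟩ := Finset.mem_image.1 hej
  rcases Sym2.eq_iff.1 h with ⟨h, -⟩ | ⟨h, -⟩
  · have := natCast_vtx_inj (by omega) (by omega) h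
    omega
  · have h' := congrArg (vtxParity m) h
    rw [map_add, vtxParity_two_mul_add_one, vtxParity_two_mul, vtxParity_two_mul] at h'
    simp at h'

lemma mem_oddStar_of_odd_val {m : ℕ} [NeZero (2 * m)] {v w : Vtx m} (h : Odd (w - v).val) :
    s(v, w) ∈ oddStar m v := by
  obtain ⟨k, hk⟩ := h
  have hlt := ZMod.val_lt (w - v)
  refine Finset.mem_image.2 ⟨k, Finset.mem_range.2 (by omega), ?_⟩
  rw [← hk, ZMod.natCast_zmod_val, add_sub_cancel]

/-- The set of all edges of direction `s`. -/
def parallelClass (m : ℕ) [NeZero (2 * m)] (s : Vtx m) : Finset (Sym2 (Vtx m)) :=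
  Finset.univ.image fun x => s(x, s - x)

lemma edgeDir_of_mem_parallelClass {m : ℕ} [NeZero (2 * m)] {s : Vtx m} {e : Sym2 (Vtx m)}
    (he : e ∈ parallelClass m s) : edgeDir m e = s := by
  obtain ⟨x, -, rfl⟩ := Finset.mem_image.1 he
  exact add_sub_cancel x s

lemma eq_of_mem_parallelClass {m : ℕ} [NeZero (2 * m)] {s x : Vtx m} {e : Sym2 (Vtx m)}
    (he : e ∈ parallelClass m s) (hx : x ∈ e) : e = s(x, s - x) := by
  obtain ⟨y, rfl⟩ := Sym2.mem_iff_exists.1 hx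
  rw [← edgeDir_of_mem_parallelClass he]
  exact congrArg (fun z => s(x, z)) (add_sub_cancel_left x y).symm

lemma inArc_reflect {m : ℕ} [NeZero (2 * m)] {a b c d : Vtx m} (h : a + b = c + d)
    (hc : InArc m a b c) : InArc m a b d := by
  have hd : d - a = (b - a) - (c - a) := by linear_combination -h
  obtain ⟨h0, h1⟩ := hc
  rw [InArc, hd, ZMod.val_sub h1.le]
  omega

lemma isSPM_parallelClass (m : ℕ) [NeZero (2 * m)] (k : ℕ) :
    IsSPM m (parallelClass m (2 * k + 1 : ℕ)) := by
  refine ⟨⟨fun e he => ?_, fun e he f hf hne x hxe hxf => hne ?_, fun x => ?_⟩, ?_⟩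
  · obtain ⟨x, -, rfl⟩ := Finset.mem_image.1 he
    rw [Sym2.mk_isDiag_iff]
    intro h
    have h' := congrArg (vtxParity m) (eq_sub_iff_add_eq.1 h)
    rw [vtxParity_two_mul_add_one, map_add, CharTwo.add_self_eq_zero] at h'
    exact zero_ne_one h'
  · rw [eq_of_mem_parallelClass he hxe, eq_of_mem_parallelClass hf hxf]
  · exact ⟨_, Finset.mem_image_of_mem _ (Finset.mem_univ x), Sym2.mem_mk_left _ _⟩
  · rintro e he f hf - ⟨a, b, c, d, rfl, rfl, h⟩
    have hab : a + b = _ := edgeDir_of_mem_parallelClass he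
    have hcd : c + d = _ := edgeDir_of_mem_parallelClass hf
    rcases h with ⟨h, h'⟩ | ⟨h, h'⟩
    · exact h' (inArc_reflect (hab.trans hcd.symm) h)
    · exact h' (inArc_reflect (hab.trans (hcd.symm.trans (add_comm c d))) h)

lemma IsPM.card_eq {m : ℕ} [NeZero (2 * m)] {M : Finset (Sym2 (Vtx m))} (hM : IsPM m M) :
    M.card = m := by
  obtain ⟨hdiag, hdisj, hcov⟩ := hM
  have hU : M.biUnion Sym2.toFinset = Finset.univ := by
    ext x
    simpa using hcov x
  have hcard := Finset.card_biUnion (s := M) (t := Sym2.toFinset) (by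
    intro e he f hf hne
    refine Finset.disjoint_left.2 fun x hx hx' => ?_
    exact hdisj e he f hf hne x (Sym2.mem_toFinset.1 hx) (Sym2.mem_toFinset.1 hx'))
  rw [hU, Finset.sum_congr rfl fun e he => Sym2.card_toFinset_of_not_isDiag e (hdiag e he),
    Finset.sum_const, Finset.card_univ, ZMod.card, smul_eq_mul] at hcard
  omega

open Classical in
lemma card_inArc {m : ℕ} [NeZero (2 * m)] (v w : Vtx m) :
    (Finset.univ.filter (InArc m v w)).card = (w - v).val - 1 := by
  have h : (Finset.univ.filter (InArc m v w)).card = (Finset.Ioo 0 (w - v).val).card := by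
    refine Finset.card_bij (fun x _ => (x - v).val) (fun x hx => ?_) (fun x _ y _ hxy => ?_)
      (fun k hk => ?_)
    · simpa [InArc] using hx
    · simpa using ZMod.val_injective _ hxy
    · have hk' := Finset.mem_Ioo.1 hk
      have hlt : k < 2 * m := hk'.2.trans (ZMod.val_lt _)
      refine ⟨v + k, ?_, ?_⟩
      · simpa [InArc, ZMod.val_cast_of_lt hlt] using hk'
      · simp [ZMod.val_cast_of_lt hlt]
  rw [h, Nat.card_Ioo, Nat.sub_zero]

/-- The vertices on either side of an edge of an SPM are matched among themselves, so that the
edge has odd order. -/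
lemma IsSPM.odd_val_sub {m : ℕ} [NeZero (2 * m)] {M : Finset (Sym2 (Vtx m))} (hM : IsSPM m M)
    {v w : Vtx m} (hvw : s(v, w) ∈ M) : Odd (w - v).val := by
  classical
  obtain ⟨⟨hdiag, hdisj, hcov⟩, hcross⟩ := hM
  have hpartner : ∀ x, ∃ y, s(x, y) ∈ M := by
    intro x
    obtain ⟨e, he, hx⟩ := hcov x
    obtain ⟨y, rfl⟩ := Sym2.mem_iff_exists.1 hx
    exact ⟨y, he⟩
  choose p hp using hpartner
  have hp_unique : ∀ x y, s(x, y) ∈ M → p x = y := by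
    intro x y hxy
    by_contra hne
    exact hdisj _ (hp x) _ hxy (fun h => hne (Sym2.congr_right.1 h)) x
      (Sym2.mem_mk_left _ _) (Sym2.mem_mk_left _ _)
  have hp_inArc : ∀ x, InArc m v w x → InArc m v w (p x) := by
    intro x hx
    by_contra hpx
    refine hcross _ hvw _ (hp x) (fun h => ?_) ⟨v, w, x, p x, rfl, rfl, Or.inl ⟨hx, hpx⟩⟩
    have hmem : x ∈ s(v, w) := h ▸ Sym2.mem_mk_left x (p x)
    rcases Sym2.mem_iff.1 hmem with rfl | rfl
    · simp [InArc] at hx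
    · exact lt_irrefl _ hx.2
  have hsum : ∑ x ∈ Finset.univ.filter (InArc m v w), (1 : ZMod 2) = 0 := by
    refine Finset.sum_involution (fun x _ => p x) (fun _ _ => CharTwo.add_self_eq_zero _)
      (fun x _ _ h => ?_) (fun x hx => ?_) (fun x _ => ?_)
    · exact hdiag _ (hp x) (Sym2.mk_isDiag_iff.2 h.symm)
    · simpa using hp_inArc x (by simpa using hx)
    · exact hp_unique _ _ (Sym2.eq_swap ▸ hp x)
  rw [Finset.sum_const, nsmul_one, card_inArc, ZMod.natCast_eq_zero_iff] at hsum
  have hpos : (w - v).val ≠ 0 := by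
    rw [Ne, ZMod.val_eq_zero, sub_eq_zero]
    exact fun h => hdiag _ hvw (Sym2.mk_isDiag_iff.2 h.symm)
  rw [Nat.odd_iff]
  omega

lemma isBlocker_oddStar (m : ℕ) [NeZero (2 * m)] (v : Vtx m) : IsBlocker m (oddStar m v) := by
  refine ⟨fun e he => not_isDiag_of_mem_oddStar he, fun M hM => ?_, fun B _ hB => ?_⟩
  · obtain ⟨e, he, hv⟩ := hM.1.2.2 v
    obtain ⟨w, rfl⟩ := Sym2.mem_iff_exists.1 hv
    exact ⟨_, Finset.mem_inter.2 ⟨mem_oddStar_of_odd_val (hM.odd_val_sub he), he⟩⟩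
  · refine (card_oddStar_le m v).trans (le_card_of_forall_inter_nonempty
      (fun k => parallelClass m (2 * k + 1 : ℕ)) (fun i hi j hj e hei hej => ?_)
      fun k _ => hB _ (isSPM_parallelClass m k))
    have := natCast_vtx_inj (by omega) (by omega)
      ((edgeDir_of_mem_parallelClass hei).symm.trans (edgeDir_of_mem_parallelClass hej))
    omega

lemma le_card_of_meets_blockers {m : ℕ} [NeZero (2 * m)] {C : Finset (Sym2 (Vtx m))}
    (hC : ∀ B, IsBlocker m B → (C ∩ B).Nonempty) : m ≤ C.card :=
  le_card_of_forall_inter_nonempty (fun j => oddStar m (2 * j : ℕ))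
    (fun _ hi _ hj _ => oddStar_even_disjoint hi hj) fun _ _ => hC _ (isBlocker_oddStar m _)

lemma IsSPM.isCoBlocker {m : ℕ} [NeZero (2 * m)] {M : Finset (Sym2 (Vtx m))} (hM : IsSPM m M) :
    IsCoBlocker m M :=
  ⟨hM.1.1, fun B hB => Finset.inter_comm B M ▸ hB.2.1 M hM,
    fun _ _ hC => hM.1.card_eq.trans_le (le_card_of_meets_blockers hC)⟩

/-- For every `m ≥ 1`, every simple perfect matching of `CGG(2m)` is a
co-blocker; in particular, every co-blocker of `CGG(2m)` has exactly `m`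
edges. -/
theorem spm_isCoBlocker_and_coBlocker_card (m : ℕ) (hm : 1 ≤ m) :
    (∀ M : Finset (Sym2 (Vtx m)), IsSPM m M → IsCoBlocker m M) ∧
    ∀ C : Finset (Sym2 (Vtx m)), IsCoBlocker m C → C.card = m := by
  have : NeZero (2 * m) := ⟨by omega⟩
  refine ⟨fun M hM => hM.isCoBlocker, fun C hC => ?_⟩
  have hM := isSPM_parallelClass m 0
  refine le_antisymm ?_ (le_card_of_meets_blockers hC.2.1)
  exact (hC.2.2 _ hM.1.1 hM.isCoBlocker.2.1).trans_eq hM.1.card_eq
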